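/- Let N be a positive integer, 𝔄 = [𝔞₁,…,𝔞ₙ] a tuple with all 𝔞ᵢ ∈ 𝔈₁, F ∈ ℤ[X₁,…,Xₙ], t a positive divisor of N, u,v,k integers with gcd(u,t)=1 and uv ≡ 1 mod t, ℓ an integer coprime to N, and ℓ* an integer with ℓℓ* ≡ 1 mod N. There exists a sequence (c_n)_{n∈ℤ} of elements of ℚ(ζ), vanishing for all n below some bound, such that for all τ in the upper half-plane T_{𝔄,F}(B(t,u,v,k)·τ) = Σ_n c_n q^n, and moreover Σ_n σ_ℓ(c_n) q^n equals T_{𝔄,F}(B(t,u,v,k)·τ) if t = N, and equals T_{𝔄,F}(B(t,ℓ*u,ℓv,ℓk)·τ) if t ≠ N, for all τ in the upper half-plane. -/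

import Mathlib

open scoped MatrixGroups
open Complex

/-- The Weierstrass ℘-function of the lattice `L_τ = ℤ + ℤτ`. -/
noncomputable def wp (τ z : ℂ) : ℂ :=
  1 / z ^ 2 + ∑' p : {p : ℤ × ℤ // p ≠ 0},
    (1 / (z - ((p.1.1 : ℂ) + (p.1.2 : ℂ) * τ)) ^ 2 - 1 / ((p.1.1 : ℂ) + (p.1.2 : ℂ) * τ) ^ 2)

/-- The function `W_𝔞` for the triple `𝔞 = [a₁,a₂,a₃]`. -/
noncomputable def Wfun (N : ℕ) (a₁ a₂ a₃ : ℤ) (τ : ℂ) : ℂ :=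
  (wp τ ((a₁ : ℂ) / N) - wp τ ((a₃ : ℂ) / N)) / (wp τ ((a₂ : ℂ) / N) - wp τ ((a₃ : ℂ) / N))

/-- Möbius action of an integral 2×2 matrix on ℂ. -/
noncomputable def moebius (A : Matrix (Fin 2) (Fin 2) ℤ) (τ : ℂ) : ℂ :=
  ((A 0 0 : ℂ) * τ + (A 0 1 : ℂ)) / ((A 1 0 : ℂ) * τ + (A 1 1 : ℂ))

/-- `𝔖_N = (ℤ/Nℤ)ˣ/{±1}`. -/
abbrev SNgroup (N : ℕ) := (ZMod N)ˣ ⧸ (Subgroup.closure ({-1} : Set (ZMod N)ˣ))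

/-- The triple `𝔞 = [a₁,a₂,a₃]` is in `𝔈`. -/
def memE (N : ℕ) (a : ℤ × ℤ × ℤ) : Prop :=
  0 < a.1 ∧ 0 < a.2.1 ∧ 0 < a.2.2 ∧ 2 * a.1 ≤ (N : ℤ) ∧ 2 * a.2.1 ≤ (N : ℤ) ∧
    2 * a.2.2 ≤ (N : ℤ) ∧ a.1 ≠ a.2.1 ∧ a.1 ≠ a.2.2 ∧ a.2.1 ≠ a.2.2

def memE1 (N : ℕ) (a : ℤ × ℤ × ℤ) : Prop :=
  memE N a ∧ IsCoprime (a.1 * a.2.1 * a.2.2) (N : ℤ)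

def memE2 (N : ℕ) (a : ℤ × ℤ × ℤ) : Prop :=
  memE1 N a ∧ IsCoprime (a.1 - a.2.2) (N : ℤ) ∧ IsCoprime (a.1 + a.2.2) (N : ℤ) ∧
    IsCoprime (a.2.1 - a.2.2) (N : ℤ) ∧ IsCoprime (a.2.1 + a.2.2) (N : ℤ)

/-- `M` is a lift to `Γ₀(N)` of `diag(λ⁻¹, λ)` for the class `s = λ ∈ 𝔖_N`. -/
def IsDiagLift (N : ℕ) (M : SL(2, ℤ)) (s : SNgroup N) : Prop :=
  ∃ u : (ZMod N)ˣ, (QuotientGroup.mk u : SNgroup N) = s ∧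
    ((M 0 0 : ℤ) : ZMod N) = ((u⁻¹ : (ZMod N)ˣ) : ZMod N) ∧
    ((M 0 1 : ℤ) : ZMod N) = 0 ∧ ((M 1 0 : ℤ) : ZMod N) = 0 ∧
    ((M 1 1 : ℤ) : ZMod N) = (u : ZMod N)

/-- The function `T_{𝔄,F}`. -/
noncomputable def Tfun (N : ℕ) {n : ℕ} (A : Fin n → ℤ × ℤ × ℤ)
    (F : MvPolynomial (Fin n) ℤ) (M : SNgroup N → SL(2, ℤ)) (τ : ℂ) : ℂ :=
  ∑ᶠ s : SNgroup N, MvPolynomial.aeval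
    (fun i => Wfun N (A i).1 (A i).2.1 (A i).2.2 (moebius ((M s : SL(2, ℤ)) : Matrix (Fin 2) (Fin 2) ℤ) τ)) F

/-- The matrix `B(t,u,v,k)`. -/
def Bmat (t : ℕ) (u v k : ℤ) : Matrix (Fin 2) (Fin 2) ℤ :=
  !![u, (u * v - 1) / (t : ℤ) + u * k; (t : ℤ), v + (t : ℤ) * k]

/-- `{a}` : the representative of `±a mod N` in `(0, N/2]` (paper's `{·}`). -/
def red (N : ℕ) (a : ℤ) : ℤ :=
  if 2 * (a % (N : ℤ)) ≤ (N : ℤ) then a % (N : ℤ) else (N : ℤ) - a % (N : ℤ)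

/-- `μ(a) ∈ {±1}` with `a ≡ μ(a){a} mod N`. -/
def muSign (N : ℕ) (a : ℤ) : ℤ :=
  if 2 * (a % (N : ℤ)) ≤ (N : ℤ) then 1 else -1

/-- `φ_s(τ) = (2πi)⁻²℘(s/N; L_τ) − 1/12`. -/
noncomputable def phiFun (N : ℕ) (s : ℤ) (τ : ℂ) : ℂ :=
  (1 / (2 * (Real.pi : ℂ) * Complex.I) ^ 2) * wp τ ((s : ℂ) / N) - 1 / 12

/-- `f[A]₂` : weight-2 slash of `φ_s`. -/
noncomputable def phiSlash (N : ℕ) (s : ℤ) (A : Matrix (Fin 2) (Fin 2) ℤ) (τ : ℂ) : ℂ :=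
  phiFun N s (moebius A τ) * ((A 1 0 : ℂ) * τ + (A 1 1 : ℂ)) ^ (-2 : ℤ)

/-- `q = e^{2πiτ/N}`. -/
noncomputable def qq (N : ℕ) (τ : ℂ) : ℂ :=
  Complex.exp (2 * (Real.pi : ℂ) * Complex.I * τ / N)

/-- `ζ = e^{2πi/N}`. -/
noncomputable def zetaN (N : ℕ) : ℂ :=
  Complex.exp (2 * (Real.pi : ℂ) * Complex.I / N)

/-- `θ_{a,b} = ζ^a(1−ζ^{b−a})(1−ζ^{b+a})/((1−ζ^a)²(1−ζ^b)²)`. -/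
noncomputable def theta (ζ : ℂ) (a b : ℤ) : ℂ :=
  ζ ^ a * (1 - ζ ^ (b - a)) * (1 - ζ ^ (b + a)) / ((1 - ζ ^ a) ^ 2 * (1 - ζ ^ b) ^ 2)

namespace PeriodPair

variable (L : PeriodPair)

lemma isPreconnected_compl_lattice : IsPreconnected ((L.lattice : Set ℂ)ᶜ) := by
  have hc : (L.lattice : Set ℂ).Countable := by
    have : Countable L.lattice := L.latticeEquivProd.toEquiv.countable_iff.mpr inferInstance
    exact Set.countable_coe_iff.mp this
  exact (hc.isPathConnected_compl_of_one_lt_rank (by simp [Complex.rank_real_complex])).isConnected.2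

lemma deriv_derivWeierstrassP {z : ℂ} (hz : z ∉ L.lattice) :
    deriv (derivWeierstrassP L) z = 6 * weierstrassP L z ^ 2 - L.g₂ / 2 := by
  have hP := L.analyticOnNhd_weierstrassP
  have hP' := L.analyticOnNhd_derivWeierstrassP
  have hg : AnalyticOnNhd ℂ (fun z => 2 * deriv (derivWeierstrassP L) z
      - 12 * weierstrassP L z ^ 2 + L.g₂) (L.lattice : Set ℂ)ᶜ :=
    fun x hx => (((analyticAt_const.mul (hP' x hx).deriv).sub
      (analyticAt_const.mul ((hP x hx).pow 2))).add analyticAt_const)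
  have hprod : ∀ x ∈ (L.lattice : Set ℂ)ᶜ, derivWeierstrassP L x *
      (2 * deriv (derivWeierstrassP L) x - 12 * weierstrassP L x ^ 2 + L.g₂) = 0 := by
    intro x hx
    have hev : (fun w => derivWeierstrassP L w ^ 2) =ᶠ[nhds x]
        fun w => 4 * weierstrassP L w ^ 3 - L.g₂ * weierstrassP L w - L.g₃ := by
      filter_upwards [L.isClosed_lattice.isOpen_compl.mem_nhds hx] with w hw
      exact L.derivWeierstrassP_sq w hw
    have hdP : HasDerivAt (weierstrassP L) (derivWeierstrassP L x) x := by
      rw [← L.deriv_weierstrassP]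
      exact (hP x hx).differentiableAt.hasDerivAt
    have hdP' := (hP' x hx).differentiableAt.hasDerivAt
    have h1 := hdP'.pow 2
    have h2 := (((hdP.pow 3).const_mul 4).sub (hdP.const_mul L.g₂)).sub_const L.g₃
    have := hev.deriv_eq
    erw [h1.deriv, h2.deriv] at this
    linear_combination this
  rcases hP'.eq_zero_or_eq_zero_of_mul_eq_zero hg hprod L.isPreconnected_compl_lattice with h | h
  · exfalso
    have hlim : Filter.Tendsto (fun z => z ^ 3 * derivWeierstrassPExcept L 0 z)
        (nhdsWithin 0 {0}ᶜ) (nhds 0) := by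
      have : ContinuousAt (fun z => z ^ 3 * derivWeierstrassPExcept L 0 z) 0 :=
        (continuousAt_id.pow 3).mul (L.analyticAt_derivWeierstrassPExcept 0).continuousAt
      simpa using this.tendsto.mono_left nhdsWithin_le_nhds
    have hc : (fun z => z ^ 3 * derivWeierstrassPExcept L 0 z) =ᶠ[nhdsWithin 0 {0}ᶜ]
        fun _ => 2 := by
      have := nhdsWithin_le_nhds (s := {(0 : ℂ)}ᶜ) (L.compl_lattice_sdiff_singleton_mem_nhds 0)
      filter_upwards [this, self_mem_nhdsWithin] with w hw hw0
      have hwL : w ∈ (L.lattice : Set ℂ)ᶜ := fun hm => hw ⟨hm, hw0⟩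
      have h3 := L.derivWeierstrassPExcept_sub 0 w
      have hw0' : w ≠ 0 := hw0
      simp only [ZeroMemClass.coe_zero, sub_zero] at h3
      rw [h w hwL, sub_eq_zero] at h3
      rw [h3]
      field_simp
    have := tendsto_nhds_unique (hlim.congr' hc) tendsto_const_nhds
    norm_num at this
  · have : 2 * deriv (derivWeierstrassP L) z - 12 * weierstrassP L z ^ 2 + L.g₂ = 0 := h z hz
    linear_combination this / 2

lemma sub_mem_lattice_of_weierstrassP_eq {x y : ℂ} (hx : x ∉ L.lattice) (hy : y ∉ L.lattice)
    (h : weierstrassP L x = weierstrassP L y)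
    (h' : derivWeierstrassP L x = derivWeierstrassP L y) : x - y ∈ L.lattice := by
  have hP := L.analyticOnNhd_weierstrassP
  have hP' := L.analyticOnNhd_derivWeierstrassP
  set c := y - x with hc
  have hshift : ∀ w, w + c ∉ L.lattice → HasDerivAt (fun w => weierstrassP L (w + c))
      (derivWeierstrassP L (w + c)) w := by
    intro w hw
    have : HasDerivAt (weierstrassP L) (derivWeierstrassP L (w + c)) (w + c) := by
      rw [← L.deriv_weierstrassP]
      exact (hP _ hw).differentiableAt.hasDerivAt
    exact this.comp_add_const w c
  set U : Set ℂ := (L.lattice : Set ℂ)ᶜ ∩ {w | w + c ∉ L.lattice} with hU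
  have hUo : IsOpen U := by
    refine L.isClosed_lattice.isOpen_compl.inter ?_
    exact L.isClosed_lattice.isOpen_compl.preimage (continuous_id.add continuous_const)
  have hxU : x ∈ U := ⟨hx, by simpa [hc] using hy⟩
  have hUc : IsPreconnected U := by
    have hcount : (L.lattice : Set ℂ).Countable := by
      have : Countable L.lattice := L.latticeEquivProd.toEquiv.countable_iff.mpr inferInstance
      exact Set.countable_coe_iff.mp this
    have h2 : ((fun w => w + c) ⁻¹' (L.lattice : Set ℂ)).Countable :=
      hcount.preimage_of_injOn (add_left_injective c).injOn
    have := ((hcount.union h2).isPathConnected_compl_of_one_lt_rank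
      (by simp [Complex.rank_real_complex])).isConnected.2
    rwa [Set.compl_union] at this
  have hA1 : AnalyticOnNhd ℂ (fun w => weierstrassP L (w + c)) U := fun w hw =>
    (hP _ hw.2).comp_of_eq (analyticAt_id.add analyticAt_const) rfl
  have hA1' : AnalyticOnNhd ℂ (fun w => derivWeierstrassP L (w + c)) U := fun w hw =>
    (hP' _ hw.2).comp_of_eq (analyticAt_id.add analyticAt_const) rfl
  set δ : ℂ → ℂ := fun w => weierstrassP L w - weierstrassP L (w + c) with hδ
  have hδA : AnalyticOnNhd ℂ δ U := fun w hw => (hP w hw.1).sub (hA1 w hw)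
  have hd1 : ∀ w ∈ U, deriv δ w = derivWeierstrassP L w - derivWeierstrassP L (w + c) := by
    intro w hw
    have h1 : HasDerivAt (weierstrassP L) (derivWeierstrassP L w) w := by
      rw [← L.deriv_weierstrassP]
      exact (hP _ hw.1).differentiableAt.hasDerivAt
    exact (h1.sub (hshift w hw.2)).deriv
  have hd2 : ∀ w ∈ U, deriv (deriv δ) w =
      6 * (weierstrassP L w + weierstrassP L (w + c)) * δ w := by
    intro w hw
    have hev : deriv δ =ᶠ[nhds w] fun w => derivWeierstrassP L w - derivWeierstrassP L (w + c) := by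
      filter_upwards [hUo.mem_nhds hw] with v hv using hd1 v hv
    rw [hev.deriv_eq]
    have h1 := (hP' _ hw.1).differentiableAt.hasDerivAt
    have h2 := ((hP' _ hw.2).differentiableAt.hasDerivAt).comp_add_const w c
    have h3 := (h1.sub h2).deriv
    have h4 : deriv (fun w => derivWeierstrassP L w - derivWeierstrassP L (w + c)) w =
      deriv (derivWeierstrassP L) w - deriv (derivWeierstrassP L) (w + c) := h3
    rw [h4, L.deriv_derivWeierstrassP hw.1, L.deriv_derivWeierstrassP hw.2]
    simp only [hδ]
    ring
  have hδx : δ x = 0 := by simp [hδ, hc, h]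
  have hδ'x : deriv δ x = 0 := by rw [hd1 x hxU]; simp [hc, h']
  have ho1 := (hδA x hxU).analyticOrderAt_deriv_add_one
  have ho2 := (hδA x hxU).deriv.analyticOrderAt_deriv_add_one
  simp only [hδx, hδ'x, sub_zero] at ho1 ho2
  have ho3 : analyticOrderAt (deriv (deriv δ)) x = analyticOrderAt (fun w =>
      6 * (weierstrassP L w + weierstrassP L (w + c))) x + analyticOrderAt δ x := by
    have hA : AnalyticAt ℂ (fun w => 6 * (weierstrassP L w + weierstrassP L (w + c))) x :=
      analyticAt_const.mul ((hP x hx).add (hA1 x hxU))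
    rw [← analyticOrderAt_mul hA (hδA x hxU)]
    apply analyticOrderAt_congr
    filter_upwards [hUo.mem_nhds hxU] with v hv using hd2 v hv
  have htop : analyticOrderAt δ x = ⊤ := by
    rw [← ho2, ho3] at ho1
    by_contra hne
    lift analyticOrderAt δ x to ℕ using hne with m hm
    change _ + (m : ℕ∞) + 1 + 1 = (m : ℕ∞) at ho1
    have hlt : (m : ℕ∞) < m + 1 := by exact_mod_cast Nat.lt_succ_self m
    have hle : (m : ℕ∞) + 1 ≤ m := by
      conv_rhs => rw [← ho1]
      exact (add_le_add_left le_add_self 1).trans le_self_add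
    exact absurd hlt (not_lt.mpr hle)
  have hzero := hδA.eqOn_zero_of_preconnected_of_eventuallyEq_zero hUc hxU
    (analyticOrderAt_eq_top.mp htop)
  by_contra hmem
  have hcL : c ∉ L.lattice := fun hcm => hmem (by
    have := L.lattice.neg_mem hcm
    simpa [hc] using this)
  have hcong : weierstrassP L =ᶠ[nhdsWithin 0 {0}ᶜ] fun w => weierstrassP L (w + c) := by
    have h1 := nhdsWithin_le_nhds (s := {(0 : ℂ)}ᶜ) (L.compl_lattice_sdiff_singleton_mem_nhds 0)
    have h2 : {w : ℂ | w + c ∉ L.lattice} ∈ nhdsWithin (0 : ℂ) {0}ᶜ := by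
      apply nhdsWithin_le_nhds
      refine IsOpen.mem_nhds ?_ (by simpa using hcL)
      exact L.isClosed_lattice.isOpen_compl.preimage (continuous_id.add continuous_const)
    filter_upwards [h1, h2, self_mem_nhdsWithin] with w hw hw2 hw0
    exact sub_eq_zero.mp (hzero ⟨fun hm => hw ⟨hm, hw0⟩, hw2⟩)
  have hord := meromorphicOrderAt_congr hcong
  rw [L.order_weierstrassP 0 (zero_mem _)] at hord
  have hA0 : AnalyticAt ℂ (fun w => weierstrassP L (w + c)) 0 :=
    (hP c hcL).comp_of_eq (analyticAt_id.add analyticAt_const) (by simp)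
  have := hA0.meromorphicOrderAt_nonneg
  rw [← hord] at this
  exact absurd this (by decide)

/-- The Weierstrass `℘`-function takes each value only at points equal up to sign
modulo the lattice. -/
theorem weierstrassP_eq_imp {x y : ℂ} (hx : x ∉ L.lattice) (hy : y ∉ L.lattice)
    (h : weierstrassP L x = weierstrassP L y) : x - y ∈ L.lattice ∨ x + y ∈ L.lattice := by
  have h2 : derivWeierstrassP L x ^ 2 = derivWeierstrassP L y ^ 2 := by
    rw [L.derivWeierstrassP_sq x hx, L.derivWeierstrassP_sq y hy, h]
  rcases sq_eq_sq_iff_eq_or_eq_neg.mp h2 with h' | h'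
  · exact Or.inl (L.sub_mem_lattice_of_weierstrassP_eq hx hy h h')
  · right
    have hy' : -y ∉ L.lattice := fun hm => hy (by simpa using L.lattice.neg_mem hm)
    have := L.sub_mem_lattice_of_weierstrassP_eq hx hy' (by rw [L.weierstrassP_neg, h])
      (by rw [L.derivWeierstrassP_neg, h'])
    simpa using this

end PeriodPair

lemma linearIndependent_one_of_im_pos {τ : ℂ} (hτ : 0 < τ.im) :
    LinearIndependent ℝ ![(1 : ℂ), τ] := by
  rw [LinearIndependent.pair_iff]
  intro s t h
  have hi := congrArg Complex.im h
  have hr := congrArg Complex.re h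
  simp at hi hr
  rcases hi with rfl | hi
  · exact ⟨by simpa using hr, rfl⟩
  · exact absurd hi hτ.ne'

/-- The period pair `(1, τ)`. -/
noncomputable def periodPairOf {τ : ℂ} (hτ : 0 < τ.im) : PeriodPair :=
  ⟨1, τ, linearIndependent_one_of_im_pos hτ⟩

lemma mem_periodPairOf_lattice {τ : ℂ} (hτ : 0 < τ.im) {z : ℂ} :
    z ∈ (periodPairOf hτ).lattice ↔ ∃ m n : ℤ, (m : ℂ) + n * τ = z := by
  simp [PeriodPair.mem_lattice, periodPairOf]

lemma hasSum_wp_aux {τ : ℂ} (hτ : 0 < τ.im) (z : ℂ) :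
    HasSum (fun p : ℤ × ℤ => 1 / (z - ((p.1 : ℂ) + (p.2 : ℂ) * τ)) ^ 2 -
      1 / ((p.1 : ℂ) + (p.2 : ℂ) * τ) ^ 2) ((periodPairOf hτ).weierstrassP z) := by
  have h := (periodPairOf hτ).hasSum_weierstrassP z
  rw [← (periodPairOf hτ).latticeEquivProd.symm.toEquiv.hasSum_iff] at h
  convert h using 2 with p
  have := (periodPairOf hτ).latticeEquiv_symm_apply p
  have h3 : (((periodPairOf hτ).latticeEquivProd.symm p : (periodPairOf hτ).lattice) : ℂ) =
      (p.1 : ℂ) + p.2 * τ := by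
    rw [this]
    simp [periodPairOf]
  simp only [Function.comp_apply, LinearEquiv.coe_toEquiv]
  rw [h3]

lemma wp_eq_weierstrassP {τ : ℂ} (hτ : 0 < τ.im) (z : ℂ) :
    wp τ z = (periodPairOf hτ).weierstrassP z := by
  have h := hasSum_wp_aux hτ z
  rw [← h.tsum_eq, ← h.summable.tsum_subtype_add_tsum_subtype_compl {0}]
  unfold wp
  congr 1
  · simp

lemma hasSum_wp {τ : ℂ} (hτ : 0 < τ.im) (z : ℂ) :
    HasSum (fun p : ℤ × ℤ => 1 / (z - ((p.1 : ℂ) + (p.2 : ℂ) * τ)) ^ 2 -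
      1 / ((p.1 : ℂ) + (p.2 : ℂ) * τ) ^ 2) (wp τ z) :=
  wp_eq_weierstrassP hτ z ▸ hasSum_wp_aux hτ z

lemma wp_ne_wp {τ : ℂ} (hτ : 0 < τ.im) {x y : ℂ}
    (hx : ∀ m n : ℤ, x ≠ m + n * τ) (hy : ∀ m n : ℤ, y ≠ m + n * τ)
    (h1 : ∀ m n : ℤ, x - y ≠ m + n * τ) (h2 : ∀ m n : ℤ, x + y ≠ m + n * τ) :
    wp τ x ≠ wp τ y := by
  intro h
  rw [wp_eq_weierstrassP hτ, wp_eq_weierstrassP hτ] at h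
  have hx' : x ∉ (periodPairOf hτ).lattice := by
    rw [mem_periodPairOf_lattice]
    rintro ⟨m, n, e⟩
    exact hx m n e.symm
  have hy' : y ∉ (periodPairOf hτ).lattice := by
    rw [mem_periodPairOf_lattice]
    rintro ⟨m, n, e⟩
    exact hy m n e.symm
  rcases PeriodPair.weierstrassP_eq_imp _ hx' hy' h with h | h <;>
    rw [mem_periodPairOf_lattice] at h <;> obtain ⟨m, n, h⟩ := h
  · exact h1 m n h.symm
  · exact h2 m n h.symm

lemma denom_ne_zero_of_im_pos {τ : ℂ} (hτ : 0 < τ.im) {c d : ℤ} (h : c ≠ 0 ∨ d ≠ 0) :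
    (c : ℂ) * τ + d ≠ 0 := by
  intro he
  have hi := congrArg Complex.im he
  simp at hi
  have hc : c = 0 := by
    rcases hi with h | h
    · exact h
    · exact absurd h hτ.ne'
  subst hc
  simp at he
  simp_all

lemma moebius_im_pos {τ : ℂ} (hτ : 0 < τ.im) {A : Matrix (Fin 2) (Fin 2) ℤ} (hA : A.det = 1) :
    0 < (moebius A τ).im := by
  let g : SL(2, ℤ) := ⟨A, hA⟩
  have h := (g • (⟨τ, hτ⟩ : UpperHalfPlane)).im_pos
  have h2 : ((g • (⟨τ, hτ⟩ : UpperHalfPlane) : UpperHalfPlane) : ℂ) = moebius A τ := by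
    rw [UpperHalfPlane.specialLinearGroup_apply]
    simp [moebius, g]
  rw [← h2]
  exact h

lemma bottom_row_ne_zero {A : Matrix (Fin 2) (Fin 2) ℤ} (hA : A.det = 1) :
    A 1 0 ≠ 0 ∨ A 1 1 ≠ 0 := by
  by_contra! h
  rw [Matrix.det_fin_two, h.1, h.2] at hA
  simp at hA

lemma wp_moebius {τ : ℂ} (hτ : 0 < τ.im) {A : Matrix (Fin 2) (Fin 2) ℤ} (hA : A.det = 1)
    (z : ℂ) : wp (moebius A τ) z =
      ((A 1 0 : ℂ) * τ + (A 1 1 : ℂ)) ^ 2 * wp τ (z * ((A 1 0 : ℂ) * τ + (A 1 1 : ℂ))) := by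
  have hj := denom_ne_zero_of_im_pos hτ (bottom_row_ne_zero hA)
  have h1 := hasSum_wp (moebius_im_pos hτ hA) z
  have h2 := hasSum_wp hτ (z * ((A 1 0 : ℂ) * τ + (A 1 1 : ℂ)))
  rw [Matrix.det_fin_two] at hA
  let e : ℤ × ℤ ≃ ℤ × ℤ :=
    { toFun := fun p => (p.1 * A 1 1 + p.2 * A 0 1, p.1 * A 1 0 + p.2 * A 0 0)
      invFun := fun p => (p.1 * A 0 0 - p.2 * A 0 1, -p.1 * A 1 0 + p.2 * A 1 1)
      left_inv := fun p => by
        ext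
        · simp only; linear_combination p.1 * hA
        · simp only; linear_combination p.2 * hA
      right_inv := fun p => by
        ext
        · simp only; linear_combination p.1 * hA
        · simp only; linear_combination p.2 * hA }
  rw [← e.hasSum_iff] at h2
  have h3 := h2.mul_left (((A 1 0 : ℂ) * τ + (A 1 1 : ℂ)) ^ 2)
  refine h1.unique (h3.congr_fun fun p => ?_)
  simp only [e, moebius, Function.comp, Equiv.coe_fn_mk]
  push_cast
  generalize hJ : (A 1 0 : ℂ) * τ + (A 1 1 : ℂ) = J at *
  have e1 : (p.1 : ℂ) + p.2 * (((A 0 0 : ℂ) * τ + A 0 1) / J) =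
      ((p.1 : ℂ) * A 1 1 + p.2 * A 0 1 + (p.1 * A 1 0 + p.2 * A 0 0) * τ) / J := by
    field_simp
    rw [← hJ]
    ring
  rw [e1]
  generalize ((p.1 : ℂ) * A 1 1 + p.2 * A 0 1 + (p.1 * A 1 0 + p.2 * A 0 0) * τ) = w
  have e2 : z - w / J = (z * J - w) / J := by field_simp
  rw [e2, div_pow, div_pow, one_div_div, one_div_div]
  ring

lemma moebius_moebius {τ : ℂ} (hτ : 0 < τ.im) {A B : Matrix (Fin 2) (Fin 2) ℤ}
    (hB : B.det = 1) :
    moebius A (moebius B τ) = moebius (A * B) τ := by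
  have hj := denom_ne_zero_of_im_pos hτ (bottom_row_ne_zero hB)
  simp only [moebius, Matrix.mul_apply, Fin.sum_univ_two]
  push_cast
  generalize hJ : (B 1 0 : ℂ) * τ + (B 1 1 : ℂ) = J at *
  have e (a b X : ℂ) : a * (X / J) + b = (a * X + b * J) / J := by field_simp
  rw [e, e, div_div_div_cancel_right₀ hj]
  subst hJ
  congr 1 <;> ring

lemma summable_one_div_add_int_sq (z : ℂ) : Summable fun m : ℤ => 1 / (z + m) ^ 2 := by
  refine (EisensteinSeries.linear_right_summable z 1 (k := 2) le_rfl).congr fun m => ?_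
  rw [one_div]
  norm_cast
  simp

lemma tsum_one_div_add_int_sq_of_im_pos {z : ℂ} (hz : 0 < z.im) :
    ∑' m : ℤ, 1 / (z + m) ^ 2 =
      (2 * (Real.pi : ℂ) * I) ^ 2 *
        (cexp (2 * Real.pi * I * z) / (1 - cexp (2 * Real.pi * I * z)) ^ 2) := by
  have h := EisensteinSeries.qExpansion_identity (k := 1) le_rfl ⟨z, hz⟩
  have hlt : ‖cexp (2 * Real.pi * I * z)‖ < 1 := by
    rw [Complex.norm_exp, Real.exp_lt_one_iff]
    have : (2 * (Real.pi : ℂ) * I * z).re = -(2 * Real.pi * z.im) := by simp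
    rw [this]
    have := Real.pi_pos
    simp only [Left.neg_neg_iff]
    positivity
  simp only [pow_one, one_add_one_eq_two, Nat.factorial_one, Nat.cast_one, div_one] at h
  rw [tsum_coe_mul_geometric_of_norm_lt_one hlt] at h
  rw [h]
  ring

lemma norm_one_div_add_int_sq_le (x : ℝ) (y : ℝ) (hx : ∀ m : ℤ, x ≠ m) (m : ℤ) :
    ‖1 / ((x + y * I : ℂ) + m) ^ 2‖ ≤ ‖1 / ((x : ℂ) + m) ^ 2‖ := by
  have h0 : (x : ℂ) + m ≠ 0 := by
    intro h
    apply hx (-m)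
    have : ((x + m : ℝ) : ℂ) = 0 := by push_cast; exact h
    have := Complex.ofReal_eq_zero.1 this
    push_cast
    linarith
  simp only [norm_div, norm_one, norm_pow]
  have h1 : ‖(x : ℂ) + m‖ ≤ ‖(x + y * I : ℂ) + m‖ := by
    have e1 : ‖(x : ℂ) + m‖ = |((x + y * I : ℂ) + m).re| := by
      have : (x : ℂ) + m = ((x + m : ℝ) : ℂ) := by push_cast; rfl
      rw [this, Complex.norm_real, Real.norm_eq_abs]
      simp
    rw [e1]
    exact Complex.abs_re_le_norm _
  have : 0 < ‖(x : ℂ) + m‖ := norm_pos_iff.2 h0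
  gcongr

lemma tsum_one_div_add_int_sq_of_real {x : ℝ} (hx : ∀ m : ℤ, x ≠ m) :
    ∑' m : ℤ, 1 / ((x : ℂ) + m) ^ 2 =
      (2 * (Real.pi : ℂ) * I) ^ 2 *
        (cexp (2 * Real.pi * I * x) / (1 - cexp (2 * Real.pi * I * x)) ^ 2) := by
  have h0 (m : ℤ) : (x : ℂ) + m ≠ 0 := by
    intro h
    apply hx (-m)
    have : ((x + m : ℝ) : ℂ) = 0 := by push_cast; exact h
    have := Complex.ofReal_eq_zero.1 this
    push_cast
    linarith
  have hE : 1 - cexp (2 * Real.pi * I * x) ≠ 0 := by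
    intro h
    obtain ⟨m, hm⟩ := Complex.exp_eq_one_iff.1 (sub_eq_zero.1 h).symm
    have hpi : (2 * (Real.pi : ℂ) * I) ≠ 0 := Complex.two_pi_I_ne_zero
    have : (x : ℂ) = (m : ℝ) := by
      apply mul_left_cancel₀ hpi
      rw [hm]; push_cast; ring
    exact hx m (by exact_mod_cast this)
  have ht : Filter.Tendsto (fun y : ℝ => (x + y * I : ℂ)) (nhdsWithin 0 (Set.Ioi 0))
      (nhds (x : ℂ)) := by
    have : Continuous (fun y : ℝ => (x + y * I : ℂ)) := by fun_prop
    have := (this.tendsto 0).mono_left (nhdsWithin_le_nhds (s := Set.Ioi (0 : ℝ)))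
    simpa using this
  have h1 : Filter.Tendsto (fun y : ℝ => ∑' m : ℤ, 1 / ((x + y * I : ℂ) + m) ^ 2)
      (nhdsWithin 0 (Set.Ioi 0)) (nhds (∑' m : ℤ, 1 / ((x : ℂ) + m) ^ 2)) := by
    refine tendsto_tsum_of_dominated_convergence
      (bound := fun m : ℤ => ‖1 / ((x : ℂ) + m) ^ 2‖)
      (summable_one_div_add_int_sq (x : ℂ)).norm (fun m => ?_)
      (Filter.Eventually.of_forall fun y m => norm_one_div_add_int_sq_le x y hx m)
    exact tendsto_const_nhds.div ((ht.add_const _).pow 2) (pow_ne_zero 2 (h0 m))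
  have h2 : Filter.Tendsto (fun y : ℝ => (2 * (Real.pi : ℂ) * I) ^ 2 *
        (cexp (2 * Real.pi * I * (x + y * I)) / (1 - cexp (2 * Real.pi * I * (x + y * I))) ^ 2))
      (nhdsWithin 0 (Set.Ioi 0)) (nhds ((2 * (Real.pi : ℂ) * I) ^ 2 *
        (cexp (2 * Real.pi * I * x) / (1 - cexp (2 * Real.pi * I * x)) ^ 2))) := by
    have he := (Complex.continuous_exp.tendsto _).comp (ht.const_mul (2 * Real.pi * I))
    exact (he.div ((he.const_sub 1).pow 2) (pow_ne_zero 2 hE)).const_mul _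
  refine tendsto_nhds_unique h1 (h2.congr' ?_)
  filter_upwards [self_mem_nhdsWithin] with y hy
  rw [tsum_one_div_add_int_sq_of_im_pos]
  simpa using hy

/-- Regrouping of a double series `∑ g r m q^{rm}` according to the exponent of `q`. -/
lemma summable_mul_pow_mul {g : ℕ → ℕ → ℂ} {C : ℝ} (hg : ∀ r m, ‖g r m‖ ≤ C * m) {q : ℂ}
    (hq : ‖q‖ < 1) :
    Summable fun p : ℕ+ × ℕ+ => g p.1 p.2 * q ^ (p.1 * p.2 : ℕ) := by
  refine Summable.of_norm_bounded ((summable_prod_mul_pow 1 hq).norm.mul_left C) fun p => ?_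
  rw [norm_mul, norm_mul, ← mul_assoc]
  gcongr
  simpa using hg p.1 p.2

lemma hasSum_divisorsAntidiagonal_mul_pow {g : ℕ → ℕ → ℂ} {C : ℝ}
    (hg : ∀ r m, ‖g r m‖ ≤ C * m) {q : ℂ} (hq : ‖q‖ < 1) :
    HasSum (fun M : ℕ => (∑ x ∈ M.divisorsAntidiagonal, g x.1 x.2) * q ^ M)
      (∑' p : ℕ+ × ℕ+, g p.1 p.2 * q ^ (p.1 * p.2 : ℕ)) := by
  have h := (summable_mul_pow_mul hg hq).hasSum
  rw [← sigmaAntidiagonalEquivProd.hasSum_iff] at h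
  have h2 := h.sigma (g := fun M : ℕ+ =>
    (∑ x ∈ (M : ℕ).divisorsAntidiagonal, g x.1 x.2) * q ^ (M : ℕ)) fun M => by
      convert hasSum_fintype (β := (M : ℕ).divisorsAntidiagonal) _ using 1
      simp only [Finset.univ_eq_attach, Function.comp, sigmaAntidiagonalEquivProd,
        divisorsAntidiagonalFactors, Equiv.coe_fn_mk, PNat.mk_coe]
      rw [(M : ℕ).divisorsAntidiagonal.sum_attach
        (fun x : ℕ × ℕ => g x.1 x.2 * q ^ (x.1 * x.2)), Finset.sum_mul]
      refine Finset.sum_congr rfl fun x hx => ?_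
      rw [(Nat.mem_divisorsAntidiagonal.1 hx).1]
  refine (Function.Injective.hasSum_iff PNat.coe_injective ?_).1 h2
  intro M hM
  have : M = 0 := by
    by_contra h0
    exact hM ⟨⟨M, Nat.pos_of_ne_zero h0⟩, rfl⟩
  simp [this]

section phiCoeff

variable {K : Type*} [Field K]

/-- The `M`-th coefficient of `∑ m η^m q^{rm}`, summed over `m ≥ 1` and over `r ≥ 1` with
`r ≡ c mod N`. -/
def posCoeff (η : K) (N : ℕ) (c : ℤ) (M : ℕ) : K :=
  ∑ x ∈ M.divisorsAntidiagonal, (x.2 : K) * if (x.1 : ℤ) ≡ c [ZMOD N] then η ^ x.2 else 0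

/-- The `M`-th coefficient of the `q`-expansion of `∑ η q^r / (1 - η q^r) ^ 2`, summed over the
integers `r ≡ c mod N`. -/
def phiCoeff (η : K) (N : ℕ) (c : ℤ) (M : ℕ) : K :=
  (if M = 0 then if (N : ℤ) ∣ c then η / (1 - η) ^ 2 else 0 else 0) +
    posCoeff η N c M + posCoeff η⁻¹ N (-c) M

lemma map_posCoeff {L : Type*} [Field L] (f : K →+* L) (η : K) (N : ℕ) (c : ℤ) (M : ℕ) :
    f (posCoeff η N c M) = posCoeff (f η) N c M := by
  simp [posCoeff, apply_ite f]

lemma map_phiCoeff {L : Type*} [Field L] (f : K →+* L) (η : K) (N : ℕ) (c : ℤ) (M : ℕ) :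
    f (phiCoeff η N c M) = phiCoeff (f η) N c M := by
  simp [phiCoeff, apply_ite f, map_posCoeff]

lemma posCoeff_congr (η : K) {N : ℕ} {c c' : ℤ} (h : c ≡ c' [ZMOD N]) (M : ℕ) :
    posCoeff η N c M = posCoeff η N c' M := by
  have (x : ℤ) : x ≡ c [ZMOD N] ↔ x ≡ c' [ZMOD N] := ⟨fun h' => h'.trans h, fun h' => h'.trans h.symm⟩
  simp [posCoeff, this]

lemma phiCoeff_congr (η : K) {N : ℕ} {c c' : ℤ} (h : c ≡ c' [ZMOD N]) (M : ℕ) :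
    phiCoeff η N c M = phiCoeff η N c' M := by
  have h2 : (N : ℤ) ∣ c ↔ (N : ℤ) ∣ c' := by
    rw [← Int.modEq_zero_iff_dvd, ← Int.modEq_zero_iff_dvd]
    exact ⟨fun h' => h.symm.trans h', fun h' => h.trans h'⟩
  simp [phiCoeff, posCoeff_congr _ h, posCoeff_congr _ h.neg, h2]

lemma phiCoeff_inv_neg (η : K) (N : ℕ) (c : ℤ) (M : ℕ) :
    phiCoeff η⁻¹ N (-c) M = phiCoeff η N c M := by
  have : η⁻¹ / (1 - η⁻¹) ^ 2 = η / (1 - η) ^ 2 := by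
    rcases eq_or_ne η 0 with rfl | h0
    · simp
    rcases eq_or_ne η 1 with rfl | h1
    · simp
    have h2 : 1 - η ≠ 0 := sub_ne_zero.2 h1.symm
    have h3 : η - 1 ≠ 0 := sub_ne_zero.2 h1
    have : 1 - η⁻¹ = (η - 1) / η := by field_simp
    rw [this]
    field_simp
    ring
  simp only [phiCoeff, neg_neg, inv_inv, this, dvd_neg]
  ring

end phiCoeff

lemma norm_natCast_mul_ite_le {η : ℂ} (hη : ‖η‖ = 1) (p : ℕ → Prop) [DecidablePred p] (r m : ℕ) :
    ‖(m : ℂ) * if p r then η ^ m else 0‖ ≤ 1 * m := by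
  split_ifs <;> simp [hη]

lemma hasSum_posCoeff {η q : ℂ} (hη : ‖η‖ = 1) (hq : ‖q‖ < 1) (N : ℕ) (c : ℤ) :
    Summable (fun M : ℕ => posCoeff η N c M * q ^ M) ∧
      HasSum (fun n : ℕ => if ((n + 1 : ℕ) : ℤ) ≡ c [ZMOD N] then
          η * q ^ (n + 1) / (1 - η * q ^ (n + 1)) ^ 2 else 0)
        (∑' M : ℕ, posCoeff η N c M * q ^ M) := by
  have hg := norm_natCast_mul_ite_le hη (fun r : ℕ => (r : ℤ) ≡ c [ZMOD N])
  have h1 := hasSum_divisorsAntidiagonal_mul_pow hg hq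
  refine ⟨h1.summable, ?_⟩
  have h2 := (summable_mul_pow_mul hg hq).hasSum
  rw [← h1.tsum_eq] at h2
  have h3 := h2.prod_fiberwise (g := fun r : ℕ+ => if ((r : ℕ) : ℤ) ≡ c [ZMOD N] then
    η * q ^ (r : ℕ) / (1 - η * q ^ (r : ℕ)) ^ 2 else 0) fun r => by
    have hlt : ‖η * q ^ (r : ℕ)‖ < 1 := by
      rw [norm_mul, hη, one_mul, norm_pow]
      exact pow_lt_one₀ (norm_nonneg _) hq r.ne_zero
    have h4 := hasSum_coe_mul_geometric_of_norm_lt_one hlt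
    rw [← Function.Injective.hasSum_iff PNat.coe_injective] at h4
    · split_ifs with hr
      · refine h4.congr_fun fun m => ?_
        simp only [Function.comp, mul_pow, pow_mul]
        ring
      · simp
    · intro M hM
      have : M = 0 := by
        by_contra h0
        exact hM ⟨⟨M, Nat.pos_of_ne_zero h0⟩, rfl⟩
      simp [this]
  rw [← Equiv.pnatEquivNat.symm.hasSum_iff] at h3
  exact h3

lemma summable_phiCoeff {η q : ℂ} (hη : ‖η‖ = 1) (hq : ‖q‖ < 1) (N : ℕ) (c : ℤ) :
    Summable (fun M : ℕ => phiCoeff η N c M * q ^ M) := by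
  simp only [phiCoeff, add_mul]
  refine Summable.add (Summable.add ?_ (hasSum_posCoeff hη hq N c).1)
    (hasSum_posCoeff (by simpa using hη) hq N (-c)).1
  refine summable_of_ne_finset_zero (s := {0}) fun M hM => ?_
  rw [if_neg (by simpa using hM), zero_mul]

lemma tsum_phiCoeff {η q : ℂ} (hη : ‖η‖ = 1) (hq : ‖q‖ < 1) (N : ℕ) (c : ℤ) :
    ∑' M : ℕ, phiCoeff η N c M * q ^ M = ∑' M : ℕ, posCoeff η N c M * q ^ M +
      (if (N : ℤ) ∣ c then η / (1 - η) ^ 2 else 0) +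
      ∑' M : ℕ, posCoeff η⁻¹ N (-c) M * q ^ M := by
  have h1 := (hasSum_posCoeff hη hq N c).1.hasSum
  have h2 := (hasSum_posCoeff (η := η⁻¹) (by simpa using hη) hq N (-c)).1.hasSum
  have h3 := hasSum_ite_eq (0 : ℕ) (if (N : ℤ) ∣ c then η / (1 - η) ^ 2 else (0 : ℂ))
  have h4 := (h1.add h3).add h2
  rw [← h4.tsum_eq]
  refine tsum_congr fun M => ?_
  simp only [phiCoeff]
  by_cases hM : M = 0
  · simp [hM]; ring
  · simp [hM]; ring

lemma mul_inv_div_one_sub_sq (w : ℂ) : w⁻¹ / (1 - w⁻¹) ^ 2 = w / (1 - w) ^ 2 := by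
  rcases eq_or_ne w 0 with rfl | h0
  · simp
  rcases eq_or_ne w 1 with rfl | h1
  · simp
  have h2 : 1 - w ≠ 0 := sub_ne_zero.2 h1.symm
  have h3 : w - 1 ≠ 0 := sub_ne_zero.2 h1
  have : 1 - w⁻¹ = (w - 1) / w := by field_simp
  rw [this]
  field_simp
  ring

lemma hasSum_phiCoeff {η q : ℂ} (hη : ‖η‖ = 1) (hq : ‖q‖ < 1) {N : ℕ} (hN : 0 < N)
    (c : ℤ) :
    HasSum (fun n : ℤ => η * q ^ (c + n * N) / (1 - η * q ^ (c + n * N)) ^ 2)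
      (∑' M : ℕ, phiCoeff η N c M * q ^ M) := by
  have hinj : Function.Injective fun n : ℤ => c + n * N := by
    intro a b hab
    simpa [hN.ne'] using hab
  have key : HasSum (fun r : ℤ => if r ≡ c [ZMOD N] then η * q ^ r / (1 - η * q ^ r) ^ 2 else 0)
      (∑' M : ℕ, phiCoeff η N c M * q ^ M) := by
    rw [tsum_phiCoeff hη hq]
    have h1 := (hasSum_posCoeff hη hq N c).2
    have h2 := (hasSum_posCoeff (η := η⁻¹) (by simpa using hη) hq N (-c)).2
    have h3 := HasSum.of_add_one_of_neg_add_one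
      (f := fun r : ℤ => if r ≡ c [ZMOD N] then η * q ^ r / (1 - η * q ^ r) ^ 2 else 0)
      (h1.congr_fun fun n => ?_) (h2.congr_fun fun n => ?_)
    · convert h3 using 3
      · simp only [zpow_zero, mul_one]
        refine if_congr ?_ rfl rfl
        rw [Int.modEq_comm, Int.modEq_zero_iff_dvd]
    · push_cast
      have : q ^ ((n : ℤ) + 1) = q ^ (n + 1) := by exact_mod_cast zpow_natCast q (n + 1)
      rw [this]
    · have : q ^ (-((n : ℤ) + 1)) = (q ^ (n + 1))⁻¹ := by
        rw [zpow_neg]; exact_mod_cast congrArg _ (zpow_natCast q (n + 1))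
      rw [this, ← mul_inv_div_one_sub_sq, mul_inv, inv_inv]
      refine if_congr ?_ rfl rfl
      push_cast
      exact ⟨fun h => by simpa using h.neg, fun h => by simpa using h.neg⟩
  rw [← hinj.hasSum_iff] at key
  · refine key.congr_fun fun n => ?_
    simp only [Function.comp]
    rw [if_pos]
    exact (Int.modEq_iff_dvd.2 ⟨-n, by ring⟩)
  · intro r hr
    rw [if_neg]
    intro h
    obtain ⟨m, hm⟩ := Int.modEq_iff_dvd.1 h.symm
    exact hr ⟨m, by simp only; linarith⟩

lemma norm_qq_lt_one {N : ℕ} (hN : 0 < N) {τ : ℂ} (hτ : 0 < τ.im) : ‖qq N τ‖ < 1 := by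
  rw [qq, Complex.norm_exp, Real.exp_lt_one_iff]
  have : (2 * (Real.pi : ℂ) * I * τ / N).re = -(2 * Real.pi * τ.im / N) := by
    rw [Complex.div_natCast_re]
    simp [neg_div]
  rw [this]
  have := Real.pi_pos
  simp only [Left.neg_neg_iff]
  positivity

lemma norm_zetaN (N : ℕ) : ‖zetaN N‖ = 1 := by
  have : 2 * (Real.pi : ℂ) * I / N = ((2 * Real.pi / N : ℝ) : ℂ) * I := by push_cast; ring
  rw [zetaN, this, Complex.norm_exp_ofReal_mul_I]

lemma cexp_torsion (N : ℕ) (τ : ℂ) (r d : ℤ) :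
    cexp (2 * Real.pi * I * ((r * τ + d) / N)) = zetaN N ^ d * qq N τ ^ r := by
  rw [zetaN, qq, ← Complex.exp_int_mul, ← Complex.exp_int_mul, ← Complex.exp_add]
  congr 1
  ring

lemma tsum_one_div_torsion_add_int_sq {N : ℕ} (hN : 0 < N) {τ : ℂ} (hτ : 0 < τ.im) {r d : ℤ}
    (h : ¬ (r = 0 ∧ (N : ℤ) ∣ d)) :
    ∑' m : ℤ, 1 / ((r * τ + d) / N + m : ℂ) ^ 2 = (2 * (Real.pi : ℂ) * I) ^ 2 *
      (zetaN N ^ d * qq N τ ^ r / (1 - zetaN N ^ d * qq N τ ^ r) ^ 2) := by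
  have him : ((r * τ + d) / N : ℂ).im = r * τ.im / N := by
    rw [Complex.div_natCast_im]
    simp
  have hN' : (0 : ℝ) < N := by exact_mod_cast hN
  rw [← cexp_torsion]
  rcases lt_trichotomy r 0 with hr | hr | hr
  · have hz : 0 < (-((r * τ + d) / N : ℂ)).im := by
      rw [Complex.neg_im, him, ← neg_div, ← neg_mul]
      have : (0 : ℝ) < -r := by simpa using hr
      positivity
    have h1 := tsum_one_div_add_int_sq_of_im_pos hz
    rw [mul_neg, Complex.exp_neg, mul_inv_div_one_sub_sq] at h1
    rw [← h1, ← (Equiv.neg ℤ).tsum_eq]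
    refine tsum_congr fun m => ?_
    simp only [Equiv.neg_apply, Int.cast_neg]
    rw [← neg_sq]
    congr 2
    ring
  · have hd : ¬ (N : ℤ) ∣ d := fun h' => h ⟨hr, h'⟩
    have e : ((r * τ + d) / N : ℂ) = ((d / N : ℝ) : ℂ) := by simp [hr]
    rw [e]
    refine tsum_one_div_add_int_sq_of_real fun m hm => hd ⟨m, ?_⟩
    rw [div_eq_iff hN'.ne'] at hm
    rw [mul_comm]
    exact_mod_cast hm
  · have hz : 0 < ((r * τ + d) / N : ℂ).im := by
      rw [him]
      have : (0 : ℝ) < r := by exact_mod_cast hr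
      positivity
    exact tsum_one_div_add_int_sq_of_im_pos hz

/-- The `q`-expansion of `(2πi)⁻²℘((cτ + d)/N)`, up to an additive constant not depending on
`c` and `d`. -/
noncomputable def phiSeries (N : ℕ) (c d : ℤ) (τ : ℂ) : ℂ :=
  ∑' M : ℕ, phiCoeff (zetaN N ^ d) N c M * qq N τ ^ M

lemma wp_sub_wp {N : ℕ} (hN : 0 < N) {τ : ℂ} (hτ : 0 < τ.im) {c d c' d' : ℤ}
    (h : ¬ ((N : ℤ) ∣ c ∧ (N : ℤ) ∣ d)) (h' : ¬ ((N : ℤ) ∣ c' ∧ (N : ℤ) ∣ d')) :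
    wp τ ((c * τ + d) / N) - wp τ ((c' * τ + d') / N) =
      (2 * (Real.pi : ℂ) * I) ^ 2 * (phiSeries N c d τ - phiSeries N c' d' τ) := by
  have hN' : (N : ℂ) ≠ 0 := by exact_mod_cast hN.ne'
  have hnorm (d : ℤ) : ‖zetaN N ^ d‖ = 1 := by simp [norm_zetaN]
  have hrow {c d : ℤ} (h : ¬ ((N : ℤ) ∣ c ∧ (N : ℤ) ∣ d)) (n : ℤ) :
      HasSum (fun m : ℤ => 1 / ((c * τ + d) / N - ((m : ℂ) + n * τ)) ^ 2)
        ((2 * (Real.pi : ℂ) * I) ^ 2 * (zetaN N ^ d * qq N τ ^ (c + (-n) * N) /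
          (1 - zetaN N ^ d * qq N τ ^ (c + (-n) * N)) ^ 2)) := by
    have hr : ¬ (c + (-n) * N = 0 ∧ (N : ℤ) ∣ d) := fun h0 =>
      h ⟨⟨n, by linear_combination h0.1⟩, h0.2⟩
    rw [← tsum_one_div_torsion_add_int_sq hN hτ hr]
    have h1 := (summable_one_div_add_int_sq (((c + (-n) * N : ℤ) * τ + d) / N)).hasSum
    rw [← (Equiv.neg ℤ).hasSum_iff] at h1
    refine h1.congr_fun fun m => ?_
    simp only [Function.comp, Equiv.neg_apply]
    push_cast
    congr 2
    field_simp
    ring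
  have hcol {c d : ℤ} : HasSum (fun n : ℤ => ((2 * (Real.pi : ℂ) * I) ^ 2 *
        (zetaN N ^ d * qq N τ ^ (c + (-n) * N) /
          (1 - zetaN N ^ d * qq N τ ^ (c + (-n) * N)) ^ 2)))
        ((2 * (Real.pi : ℂ) * I) ^ 2 * phiSeries N c d τ) := by
    have h1 := (hasSum_phiCoeff (hnorm d) (norm_qq_lt_one hN hτ) hN c).mul_left
      ((2 * (Real.pi : ℂ) * I) ^ 2)
    rw [← (Equiv.neg ℤ).hasSum_iff] at h1
    exact h1
  have h1 := (hasSum_wp hτ ((c * τ + d) / N)).sub (hasSum_wp hτ ((c' * τ + d') / N))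
  rw [← (Equiv.prodComm ℤ ℤ).hasSum_iff] at h1
  have h2 := h1.prod_fiberwise fun n => (((hrow h n).sub (hrow h' n)).congr_fun fun m => by
    simp only [Function.comp, Equiv.prodComm_apply, Prod.swap]
    ring)
  rw [h2.unique (hcol.sub hcol), mul_sub]

lemma qq_ne_zero (N : ℕ) (τ : ℂ) : qq N τ ≠ 0 := Complex.exp_ne_zero _

lemma isPrimitiveRoot_zetaN {N : ℕ} (hN : 0 < N) : IsPrimitiveRoot (zetaN N) N :=
  Complex.isPrimitiveRoot_exp N hN.ne'

lemma zetaN_zpow_congr {N : ℕ} (hN : 0 < N) {d d' : ℤ} (h : d ≡ d' [ZMOD N]) :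
    zetaN N ^ d = zetaN N ^ d' := by
  have h0 : zetaN N ≠ 0 := Complex.exp_ne_zero _
  obtain ⟨m, hm⟩ := Int.modEq_iff_dvd.1 h
  have : d' = d + N * m := by linear_combination hm
  rw [this, zpow_add₀ h0, zpow_mul, zpow_natCast, (isPrimitiveRoot_zetaN hN).pow_eq_one]
  simp

lemma phiSeries_congr {N : ℕ} (hN : 0 < N) {c d c' d' : ℤ} (hc : c ≡ c' [ZMOD N])
    (hd : d ≡ d' [ZMOD N]) (τ : ℂ) : phiSeries N c d τ = phiSeries N c' d' τ := by
  simp only [phiSeries, zetaN_zpow_congr hN hd, phiCoeff_congr _ hc]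

/-- The row `(c, d)` is primitive modulo `N`. -/
def IsPrimitiveRow (N : ℕ) (c d : ℤ) : Prop :=
  ∀ e : ℤ, (N : ℤ) ∣ e * c → (N : ℤ) ∣ e * d → (N : ℤ) ∣ e

lemma isPrimitiveRow_of_modEq {N : ℕ} {c d x y : ℤ} (h : x * c + y * d ≡ 1 [ZMOD N]) :
    IsPrimitiveRow N c d := by
  intro e hc hd
  obtain ⟨m, hm⟩ := Int.modEq_iff_dvd.1 h
  have : e = x * (e * c) + y * (e * d) + N * (m * e) := by linear_combination e * hm
  rw [this]
  exact dvd_add (dvd_add (hc.mul_left _) (hd.mul_left _)) (dvd_mul_right _ _)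

lemma dvd_of_torsion_eq {N : ℕ} (hN : 0 < N) {τ : ℂ} (hτ : 0 < τ.im) {c d m n : ℤ}
    (h : ((c * τ + d) / N : ℂ) = m + n * τ) : (N : ℤ) ∣ c ∧ (N : ℤ) ∣ d := by
  have hN' : (N : ℂ) ≠ 0 := by exact_mod_cast hN.ne'
  rw [div_eq_iff hN'] at h
  have him := congrArg Complex.im h
  simp only [add_im, mul_im, intCast_re, intCast_im, zero_mul, add_zero, natCast_im, mul_zero,
    add_re, mul_re, natCast_re, zero_add, sub_zero] at him
  have hc : c = N * n := by
    have : (c : ℝ) = N * n := by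
      apply mul_right_cancel₀ hτ.ne'
      linear_combination him
    exact_mod_cast this
  have hd : d = N * m := by
    have : (d : ℂ) = N * m := by
      rw [hc] at h
      push_cast at h
      linear_combination h
    exact_mod_cast this
  exact ⟨⟨n, hc⟩, ⟨m, hd⟩⟩

lemma not_dvd_mul_of_isPrimitiveRow {N : ℕ} {c d : ℤ} (hcd : IsPrimitiveRow N c d) {e : ℤ}
    (he : ¬ (N : ℤ) ∣ e) : ¬ ((N : ℤ) ∣ e * c ∧ (N : ℤ) ∣ e * d) :=
  fun h => he (hcd e h.1 h.2)

lemma not_dvd_of_pos_of_two_mul_le {N : ℕ} {a : ℤ} (h0 : 0 < a) (h1 : 2 * a ≤ N) :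
    ¬ (N : ℤ) ∣ a := fun h => by
  have := Int.le_of_dvd h0 h
  lia

lemma phiSeries_ne {N : ℕ} (hN : 0 < N) {τ : ℂ} (hτ : 0 < τ.im) {c d a b : ℤ}
    (hcd : IsPrimitiveRow N c d) (ha : 0 < a) (ha' : 2 * a ≤ N) (hb : 0 < b) (hb' : 2 * b ≤ N)
    (hab : a ≠ b) :
    phiSeries N (a * c) (a * d) τ - phiSeries N (b * c) (b * d) τ ≠ 0 := by
  have ha1 := not_dvd_of_pos_of_two_mul_le ha ha'
  have hb1 := not_dvd_of_pos_of_two_mul_le hb hb'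
  have hlat {e : ℤ} (he : ¬ (N : ℤ) ∣ e) (m n : ℤ) :
      (((e * c : ℤ) * τ + (e * d : ℤ)) / N : ℂ) ≠ m + n * τ := fun h =>
    not_dvd_mul_of_isPrimitiveRow hcd he (dvd_of_torsion_eq hN hτ h)
  have hsub : ¬ (N : ℤ) ∣ a - b := fun h => by
    have := Int.eq_zero_of_abs_lt_dvd h (by rw [abs_lt]; constructor <;> lia)
    lia
  have hadd : ¬ (N : ℤ) ∣ a + b := fun h => by
    have := Int.eq_zero_of_abs_lt_dvd h (by rw [abs_lt]; constructor <;> lia)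
    lia
  have h := wp_ne_wp hτ (hlat ha1) (hlat hb1)
    (fun m n h => hlat hsub m n (by rw [← h]; push_cast; ring))
    (fun m n h => hlat hadd m n (by rw [← h]; push_cast; ring))
  have h2 := sub_ne_zero.2 h
  rw [wp_sub_wp hN hτ (not_dvd_mul_of_isPrimitiveRow hcd ha1)
    (not_dvd_mul_of_isPrimitiveRow hcd hb1)] at h2
  exact right_ne_zero_of_mul h2

/-- The `q`-expansion of `W_𝔞 ∘ A` in terms of the bottom row `(c, d)` of `A`. -/
noncomputable def Wseries (N : ℕ) (a : ℤ × ℤ × ℤ) (c d : ℤ) (τ : ℂ) : ℂ :=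
  (phiSeries N (a.1 * c) (a.1 * d) τ - phiSeries N (a.2.2 * c) (a.2.2 * d) τ) /
    (phiSeries N (a.2.1 * c) (a.2.1 * d) τ - phiSeries N (a.2.2 * c) (a.2.2 * d) τ)

lemma Wseries_congr {N : ℕ} (hN : 0 < N) (a : ℤ × ℤ × ℤ) {c d c' d' : ℤ}
    (hc : c ≡ c' [ZMOD N]) (hd : d ≡ d' [ZMOD N]) (τ : ℂ) :
    Wseries N a c d τ = Wseries N a c' d' τ := by
  simp only [Wseries, phiSeries_congr hN (hc.mul_left _) (hd.mul_left _)]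

lemma phiSeries_neg (N : ℕ) (c d : ℤ) (τ : ℂ) :
    phiSeries N (-c) (-d) τ = phiSeries N c d τ := by
  simp only [phiSeries, zpow_neg, phiCoeff_inv_neg]

lemma Wseries_neg (N : ℕ) (a : ℤ × ℤ × ℤ) (c d : ℤ) (τ : ℂ) :
    Wseries N a (-c) (-d) τ = Wseries N a c d τ := by
  simp only [Wseries, mul_neg, phiSeries_neg]

lemma Wfun_moebius {N : ℕ} (hN : 0 < N) {τ : ℂ} (hτ : 0 < τ.im) {a : ℤ × ℤ × ℤ}
    (ha : memE N a) {A : Matrix (Fin 2) (Fin 2) ℤ} (hA : A.det = 1) :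
    Wfun N a.1 a.2.1 a.2.2 (moebius A τ) = Wseries N a (A 1 0) (A 1 1) τ := by
  obtain ⟨h1, h2, h3, h1', h2', h3', -, -, -⟩ := ha
  have hj := denom_ne_zero_of_im_pos hτ (bottom_row_ne_zero hA)
  have hcd : IsPrimitiveRow N (A 1 0) (A 1 1) := by
    apply isPrimitiveRow_of_modEq (x := -A 0 1) (y := A 0 0)
    rw [Matrix.det_fin_two] at hA
    rw [← hA]
    show _ % _ = _ % _
    congr 1
    ring
  have he (e : ℤ) : (e : ℂ) / N * ((A 1 0 : ℂ) * τ + (A 1 1 : ℂ)) =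
      (((e * A 1 0 : ℤ) : ℂ) * τ + ((e * A 1 1 : ℤ) : ℂ)) / N := by push_cast; ring
  have hsub {e f : ℤ} (he : ¬ (N : ℤ) ∣ e) (hf : ¬ (N : ℤ) ∣ f) :=
    wp_sub_wp hN hτ (not_dvd_mul_of_isPrimitiveRow hcd he) (not_dvd_mul_of_isPrimitiveRow hcd hf)
  have h1 := not_dvd_of_pos_of_two_mul_le h1 h1'
  have h2 := not_dvd_of_pos_of_two_mul_le h2 h2'
  have h3 := not_dvd_of_pos_of_two_mul_le h3 h3'
  rw [Wfun, wp_moebius hτ hA, wp_moebius hτ hA, wp_moebius hτ hA, ← mul_sub, ← mul_sub,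
    mul_div_mul_left _ _ (pow_ne_zero 2 hj), he, he, he, hsub h1 h3, hsub h2 h3,
    mul_div_mul_left _ _ (pow_ne_zero 2 Complex.two_pi_I_ne_zero), Wseries]

open PowerSeries in
/-- The power series `a` converges at `q` with sum `s`. -/
def EvalsTo (a : PowerSeries ℂ) (q s : ℂ) : Prop :=
  HasSum (fun n : ℕ => coeff n a * q ^ n) s

namespace EvalsTo

open PowerSeries

variable {a b : PowerSeries ℂ} {q s t : ℂ}

lemma add (ha : EvalsTo a q s) (hb : EvalsTo b q t) : EvalsTo (a + b) q (s + t) := by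
  simpa only [EvalsTo, map_add, add_mul] using HasSum.add ha hb

lemma mul (ha : EvalsTo a q s) (hb : EvalsTo b q t) : EvalsTo (a * b) q (s * t) := by
  have h1 := ha.summable.norm
  have h2 := hb.summable.norm
  have h3 := (summable_norm_sum_mul_antidiagonal_of_summable_norm h1 h2).of_norm.hasSum
  rw [← tsum_mul_tsum_eq_tsum_sum_antidiagonal_of_summable_norm h1 h2, ha.tsum_eq,
    hb.tsum_eq] at h3
  refine h3.congr_fun fun n => ?_
  rw [coeff_mul, Finset.sum_mul]
  refine Finset.sum_congr rfl fun x hx => ?_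
  rw [← Finset.HasAntidiagonal.mem_antidiagonal.1 hx, pow_add]
  ring

lemma const (z q : ℂ) : EvalsTo (C z) q z := by
  have h := hasSum_single (f := fun n : ℕ => coeff n (C z) * q ^ n) 0 fun n hn => by
    simp [coeff_C, hn]
  simpa [EvalsTo] using h

lemma X_pow (k : ℕ) (q : ℂ) : EvalsTo (X ^ k) q (q ^ k) := by
  have h := hasSum_single (f := fun n : ℕ => coeff n (X ^ k : PowerSeries ℂ) * q ^ n) k
    fun n hn => by simp [coeff_X_pow, hn]
  simpa [EvalsTo] using h

lemma of_X_pow_mul {k : ℕ} (hq : q ≠ 0) (h : EvalsTo (X ^ k * a) q (q ^ k * s)) :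
    EvalsTo a q s := by
  have hk : Function.Injective fun n : ℕ => n + k := add_left_injective k
  have h1 := (hk.hasSum_iff (f := fun n : ℕ => coeff n (X ^ k * a) * q ^ n) fun n hn => by
    have : n < k := by
      by_contra! h0
      exact hn ⟨n - k, by simp only; lia⟩
    simp [coeff_X_pow_mul', this]).2 h
  have h2 := h1.mul_left (q ^ k)⁻¹
  rw [inv_mul_cancel_left₀ (pow_ne_zero k hq)] at h2
  refine h2.congr_fun fun n => ?_
  simp only [Function.comp, coeff_X_pow_mul, pow_add]
  field_simp

lemma zero_right (a : PowerSeries ℂ) : EvalsTo a 0 (constantCoeff a) := by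
  have h := hasSum_single (f := fun n : ℕ => coeff n a * 0 ^ n) 0 fun n hn => by simp [hn]
  simpa [EvalsTo] using h

end EvalsTo

open PowerSeries in
lemma eq_of_evalsTo {a b : PowerSeries ℂ} {f : ℂ → ℂ}
    (ha : ∀ q : ℂ, ‖q‖ < 1 → EvalsTo a q (f q)) (hb : ∀ q : ℂ, ‖q‖ < 1 → EvalsTo b q (f q)) :
    a = b := by
  have key {c : PowerSeries ℂ} (hc : ∀ q : ℂ, ‖q‖ < 1 → EvalsTo c q (f q)) :
      HasFPowerSeriesAt f (FormalMultilinearSeries.ofScalars ℂ fun n => coeff n c) 0 := by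
    rw [hasFPowerSeriesAt_iff]
    filter_upwards [Metric.ball_mem_nhds (0 : ℂ) one_pos] with z hz
    rw [zero_add]
    refine HasSum.congr_fun (hc z (by simpa using hz)) fun n => ?_
    simp [mul_comm]
  have h := (key ha).eq_formalMultilinearSeries (key hb)
  ext n
  simpa using congrArg (fun p : FormalMultilinearSeries ℂ ℂ ℂ => p.coeff n) h

open PowerSeries in
lemma EvalsTo.inv {a : PowerSeries ℂ} {f : ℂ → ℂ} (ha : ∀ q : ℂ, ‖q‖ < 1 → EvalsTo a q (f q))
    (hf : ∀ q : ℂ, ‖q‖ < 1 → f q ≠ 0) {q : ℂ} (hq : ‖q‖ < 1) : EvalsTo a⁻¹ q (f q)⁻¹ := by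
  have hd (z : ℂ) (hz : ‖z‖ < 1) : DifferentiableAt ℂ f z := by
    obtain ⟨r, hzr, hr⟩ := exists_between hz
    have hr0 : 0 < r := (norm_nonneg z).trans_lt hzr
    have hs : Summable fun n : ℕ => ‖coeff n a‖ * r ^ n := by
      have := (ha (r : ℂ) (by simpa [abs_of_pos hr0] using hr)).summable.norm
      simpa [abs_of_pos hr0] using this
    have h1 : DifferentiableOn ℂ (fun w : ℂ => ∑' n : ℕ, coeff n a * w ^ n)
        (Metric.ball 0 r) := by
      refine Complex.differentiableOn_tsum_of_summable_norm hs (fun n => by fun_prop)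
        Metric.isOpen_ball fun n w hw => ?_
      rw [norm_mul, norm_pow]
      have : ‖w‖ ≤ r := (by simpa using hw : ‖w‖ < r).le
      gcongr
    have hmem : Metric.ball (0 : ℂ) r ∈ nhds z := Metric.isOpen_ball.mem_nhds (by simpa using hzr)
    refine (h1.differentiableAt hmem).congr_of_eventuallyEq ?_
    filter_upwards [hmem] with w hw
    exact (ha w ((by simpa using hw : ‖w‖ < r).trans hr)).tsum_eq.symm
  have hd' : DifferentiableOn ℂ (fun z => (f z)⁻¹) (Metric.ball 0 1) := fun z hz => by
    have hz' : ‖z‖ < 1 := by simpa using hz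
    exact ((hd z hz').inv (hf z hz')).differentiableWithinAt
  set b : PowerSeries ℂ :=
    PowerSeries.mk fun n => ((n.factorial : ℂ))⁻¹ * iteratedDeriv n (fun z => (f z)⁻¹) 0 with hb
  have hbe (z : ℂ) (hz : ‖z‖ < 1) : EvalsTo b z (f z)⁻¹ := by
    have h := Complex.hasSum_taylorSeries_on_ball (r := 1) hd' (z := z) (by simpa using hz)
    refine h.congr_fun fun n => ?_
    simp [hb]
    ring
  have hab : b * a = 1 := by
    refine eq_of_evalsTo (f := fun _ => 1) (fun z hz => ?_) fun z _ => ?_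
    · have := (hbe z hz).mul (ha z hz)
      rwa [inv_mul_cancel₀ (hf z hz)] at this
    · simpa using EvalsTo.const 1 z
  have h0 : constantCoeff a ≠ 0 := fun h => by
    have := congrArg constantCoeff hab
    simp [h] at this
  rw [← (PowerSeries.eq_inv_iff_mul_eq_one h0).2 hab]
  exact hbe q hq

lemma exists_qq_eq {N : ℕ} (hN : 0 < N) {q : ℂ} (hq0 : q ≠ 0) (hq : ‖q‖ < 1) :
    ∃ τ : ℂ, 0 < τ.im ∧ qq N τ = q := by
  have hN' : (N : ℂ) ≠ 0 := by exact_mod_cast hN.ne'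
  refine ⟨N * Complex.log q / (2 * Real.pi * I), ?_, ?_⟩
  · have : N * Complex.log q / (2 * Real.pi * I) = ((N / (2 * Real.pi) : ℝ) : ℂ) *
        (-(Complex.log q * I)) := by
      have : (Real.pi : ℂ) ≠ 0 := by exact_mod_cast Real.pi_ne_zero
      push_cast
      field_simp
      rw [I_sq]
      ring
    rw [this, Complex.im_ofReal_mul]
    have h1 : (-(Complex.log q * I)).im = -Real.log ‖q‖ := by simp [Complex.log_re]
    rw [h1]
    have h2 := Real.log_neg (norm_pos_iff.2 hq0) hq
    have := Real.pi_pos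
    have hN'' : (0 : ℝ) < N := by exact_mod_cast hN
    have : 0 < -Real.log ‖q‖ := by linarith
    positivity
  · rw [qq, ← Complex.exp_log hq0]
    congr 1
    rw [Complex.exp_log hq0]
    have := Complex.two_pi_I_ne_zero
    field_simp

/-- The functions `g i` have expansions in powers of `q = qq N τ`, with finitely many negative
exponents, whose coefficients are the images under the embeddings `ι i` of one and the same
sequence. -/
def HasCommonExpansion {K J : Type*} [Field K] (ι : J → K →+* ℂ) (N : ℕ) (g : J → ℂ → ℂ) : Prop :=
  ∃ (k : ℕ) (p : PowerSeries K), ∀ i τ, 0 < τ.im →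
    EvalsTo (PowerSeries.map (ι i) p) (qq N τ) (qq N τ ^ k * g i τ)

namespace HasCommonExpansion

open PowerSeries

variable {K J : Type*} [Field K] {ι : J → K →+* ℂ} {N : ℕ} {f g : J → ℂ → ℂ}

lemma intCast (z : ℤ) : HasCommonExpansion ι N fun _ _ => (z : ℂ) :=
  ⟨0, C (z : K), fun i τ _ => by simpa using EvalsTo.const (z : ℂ) (qq N τ)⟩

lemma add (hf : HasCommonExpansion ι N f) (hg : HasCommonExpansion ι N g) :
    HasCommonExpansion ι N fun i τ => f i τ + g i τ := by
  obtain ⟨k, p, hp⟩ := hf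
  obtain ⟨k', p', hp'⟩ := hg
  refine ⟨k + k', X ^ k' * p + X ^ k * p', fun i τ hτ => ?_⟩
  have h := ((EvalsTo.X_pow k' (qq N τ)).mul (hp i τ hτ)).add
    ((EvalsTo.X_pow k (qq N τ)).mul (hp' i τ hτ))
  simp only [map_add, map_mul, map_pow, map_X]
  convert h using 1
  ring

lemma mul (hf : HasCommonExpansion ι N f) (hg : HasCommonExpansion ι N g) :
    HasCommonExpansion ι N fun i τ => f i τ * g i τ := by
  obtain ⟨k, p, hp⟩ := hf
  obtain ⟨k', p', hp'⟩ := hg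
  refine ⟨k + k', p * p', fun i τ hτ => ?_⟩
  rw [map_mul]
  convert (hp i τ hτ).mul (hp' i τ hτ) using 1
  ring

lemma sub (hf : HasCommonExpansion ι N f) (hg : HasCommonExpansion ι N g) :
    HasCommonExpansion ι N fun i τ => f i τ - g i τ := by
  have := hf.add ((intCast (-1)).mul hg)
  simpa [sub_eq_add_neg] using this

lemma sum {σ : Type*} (s : Finset σ) {h : σ → J → ℂ → ℂ}
    (hh : ∀ x, HasCommonExpansion ι N (h x)) :
    HasCommonExpansion ι N fun i τ => ∑ x ∈ s, h x i τ := by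
  classical
  induction s using Finset.induction_on with
  | empty => simpa using intCast (ι := ι) (N := N) 0
  | insert a s ha ih =>
    simp only [Finset.sum_insert ha]
    exact (hh a).add ih

lemma aeval {n : ℕ} (F : MvPolynomial (Fin n) ℤ) {h : Fin n → J → ℂ → ℂ}
    (hh : ∀ x, HasCommonExpansion ι N (h x)) :
    HasCommonExpansion ι N fun i τ => MvPolynomial.aeval (fun x => h x i τ) F := by
  induction F using MvPolynomial.induction_on with
  | C z => simpa using intCast z
  | add p q hp hq => simpa using hp.add hq
  | mul_X p x hp => simpa using hp.mul (hh x)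

lemma div [Nonempty J] (hN : 0 < N) (hf : HasCommonExpansion ι N f)
    (hg : HasCommonExpansion ι N g) (hg0 : ∀ i τ, 0 < τ.im → g i τ ≠ 0) :
    HasCommonExpansion ι N fun i τ => f i τ / g i τ := by
  obtain ⟨k, p, hp⟩ := hf
  obtain ⟨k', p', hp'⟩ := hg
  have hp0 : p' ≠ 0 := by
    rintro rfl
    have h := hp' (Classical.arbitrary J) I (by simp)
    have h2 : (_ : ℂ) = 0 := HasSum.unique h (by simp)
    exact mul_ne_zero (pow_ne_zero _ (qq_ne_zero _ _)) (hg0 _ I (by simp)) h2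
  obtain ⟨m, w, hw0, hw⟩ : ∃ (m : ℕ) (w : PowerSeries K), constantCoeff w ≠ 0 ∧ p' = X ^ m * w :=
    ⟨_, _, constantCoeff_divXPowOrder_eq_zero_iff.not.2 hp0, (X_pow_order_mul_divXPowOrder).symm⟩
  refine ⟨k + m, p * X ^ k' * w⁻¹, fun i τ hτ => ?_⟩
  have hw0' : constantCoeff (map (ι i) w) ≠ 0 := by
    rw [← coeff_zero_eq_constantCoeff_apply, coeff_map]
    simpa using hw0
  have hinv : map (ι i) w⁻¹ = (map (ι i) w)⁻¹ := by
    rw [PowerSeries.eq_inv_iff_mul_eq_one hw0', ← map_mul,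
      PowerSeries.inv_mul_cancel _ hw0, map_one]
  have hev (τ : ℂ) (hτ : 0 < τ.im) :
      EvalsTo (map (ι i) w) (qq N τ) (qq N τ ^ k' * g i τ / qq N τ ^ m) := by
    refine EvalsTo.of_X_pow_mul (k := m) (qq_ne_zero N τ) ?_
    have h := hp' i τ hτ
    rw [hw, map_mul, map_pow, map_X] at h
    rwa [mul_div_cancel₀ _ (pow_ne_zero m (qq_ne_zero N τ))]
  have hne (τ : ℂ) (hτ : 0 < τ.im) : qq N τ ^ k' * g i τ / qq N τ ^ m ≠ 0 :=
    div_ne_zero (mul_ne_zero (pow_ne_zero _ (qq_ne_zero N τ)) (hg0 i τ hτ))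
      (pow_ne_zero _ (qq_ne_zero N τ))
  have hall (q : ℂ) (hq : ‖q‖ < 1) : ∃ s, EvalsTo (map (ι i) w) q s ∧ s ≠ 0 := by
    rcases eq_or_ne q 0 with rfl | hq0
    · exact ⟨_, EvalsTo.zero_right _, hw0'⟩
    · obtain ⟨τ', hτ', rfl⟩ := exists_qq_eq hN hq0 hq
      exact ⟨_, hev τ' hτ', hne τ' hτ'⟩
  have hsum (q : ℂ) (hq : ‖q‖ < 1) : EvalsTo (map (ι i) w) q
      (∑' n : ℕ, coeff n (map (ι i) w) * q ^ n) := (hall q hq).choose_spec.1.summable.hasSum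
  have h1 := EvalsTo.inv hsum (fun q hq => by
    obtain ⟨s, hs, hs0⟩ := hall q hq
    rwa [hs.tsum_eq]) (norm_qq_lt_one hN hτ)
  rw [(hev τ hτ).tsum_eq] at h1
  rw [map_mul, map_mul, hinv, map_pow, map_X]
  convert ((hp i τ hτ).mul (EvalsTo.X_pow k' (qq N τ))).mul h1 using 1
  have := qq_ne_zero N τ
  have := hg0 i τ hτ
  field_simp
  ring

variable {ξ : K} {l : J → ℤ}

lemma phiSeries (hN : 0 < N) (hι : ∀ i, ι i ξ = zetaN N ^ l i) (c d : ℤ) :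
    HasCommonExpansion ι N fun i τ => phiSeries N c (l i * d) τ := by
  refine ⟨0, PowerSeries.mk (phiCoeff (ξ ^ d) N c), fun i τ hτ => ?_⟩
  have h := (summable_phiCoeff (η := zetaN N ^ (l i * d)) (by simp [norm_zetaN])
    (norm_qq_lt_one hN hτ) N c).hasSum
  rw [pow_zero, one_mul]
  refine HasSum.congr_fun h fun n => ?_
  simp [map_phiCoeff, hι, zpow_mul]

lemma Wseries [Nonempty J] (hN : 0 < N) (hι : ∀ i, ι i ξ = zetaN N ^ l i) {a : ℤ × ℤ × ℤ}
    (ha : memE N a) {c d : ℤ} (hcd : ∀ i, IsPrimitiveRow N c (l i * d)) :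
    HasCommonExpansion ι N fun i τ => Wseries N a c (l i * d) τ := by
  obtain ⟨-, h2, h3, -, h2', h3', -, -, h23⟩ := ha
  have key (e : ℤ) : HasCommonExpansion ι N
      fun i τ => _root_.phiSeries N (e * c) (e * (l i * d)) τ := by
    simpa only [mul_left_comm] using phiSeries hN hι (e * c) (e * d)
  exact ((key _).sub (key _)).div hN ((key _).sub (key _)) fun i τ hτ =>
    phiSeries_ne hN hτ (hcd i) h2 h2' h3 h3' h23

end HasCommonExpansion

lemma det_Bmat {t : ℕ} {u v : ℤ} (huv : u * v ≡ 1 [ZMOD (t : ℤ)]) (k : ℤ) :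
    (Bmat t u v k).det = 1 := by
  have h : (t : ℤ) * ((u * v - 1) / t) = u * v - 1 :=
    Int.mul_ediv_cancel' (Int.modEq_iff_dvd.1 huv.symm)
  rw [Bmat, Matrix.det_fin_two_of]
  linear_combination -h

lemma Tfun_moebius_Bmat {N : ℕ} (hN : 0 < N) {n : ℕ} {A : Fin n → ℤ × ℤ × ℤ}
    (hA : ∀ i, memE N (A i)) (F : MvPolynomial (Fin n) ℤ) {M : SNgroup N → SL(2, ℤ)}
    (hM : ∀ s, M s ∈ CongruenceSubgroup.Gamma0 N) {t : ℕ} {u v : ℤ}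
    (huv : u * v ≡ 1 [ZMOD (t : ℤ)]) (k : ℤ) {τ : ℂ} (hτ : 0 < τ.im) :
    Tfun N A F M (moebius (Bmat t u v k) τ) = ∑ᶠ s : SNgroup N, MvPolynomial.aeval
      (fun i => Wseries N (A i) (M s 1 1 * t) (M s 1 1 * (v + t * k)) τ) F := by
  refine finsum_congr fun s => ?_
  congr 2
  funext i
  have hB := det_Bmat huv k
  have hMB : ((M s : Matrix (Fin 2) (Fin 2) ℤ) * Bmat t u v k).det = 1 := by
    rw [Matrix.det_mul, hB, mul_one]
    exact (M s).2
  rw [moebius_moebius hτ hB, Wfun_moebius hN hτ (hA i) hMB]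
  have h10 : (N : ℤ) ∣ M s 1 0 :=
    (ZMod.intCast_zmod_eq_zero_iff_dvd _ _).1 (CongruenceSubgroup.Gamma0_mem.1 (hM s))
  have hrow (x y : ℤ) : M s 1 0 * x + y ≡ y [ZMOD N] := by
    have := (Int.modEq_zero_iff_dvd.2 (h10.mul_right x)).add_right y
    simpa using this
  refine Wseries_congr hN (A i) ?_ ?_ τ
  · simpa [Matrix.mul_apply, Bmat] using hrow u (M s 1 1 * t)
  · simpa [Matrix.mul_apply, Bmat] using hrow ((u * v - 1) / t + u * k) (M s 1 1 * (v + t * k))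

lemma eq_or_eq_neg_of_mk_eq {N : ℕ} {a b : (ZMod N)ˣ}
    (h : (QuotientGroup.mk a : SNgroup N) = QuotientGroup.mk b) : b = a ∨ b = -a := by
  have hmem := QuotientGroup.eq.1 h
  have key : a⁻¹ * b = 1 ∨ a⁻¹ * b = -1 := by
    generalize a⁻¹ * b = x at hmem
    induction hmem using Subgroup.closure_induction with
    | mem x hx => exact Or.inr hx
    | one => exact Or.inl rfl
    | mul x y _ _ hx hy => rcases hx with rfl | rfl <;> rcases hy with rfl | rfl <;> simp
    | inv x _ hx => rcases hx with rfl | rfl <;> simp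
  rcases key with h | h
  · exact Or.inl (inv_mul_eq_one.1 h).symm
  · right
    rw [inv_mul_eq_iff_eq_mul] at h
    simpa using h

/-- Multiplying the second entry of the rows by a unit `l` modulo `N` permutes the summands. -/
lemma finsum_Wseries_mul {N : ℕ} (hN : 0 < N) {n : ℕ} (A : Fin n → ℤ × ℤ × ℤ)
    (F : MvPolynomial (Fin n) ℤ) {M : SNgroup N → SL(2, ℤ)} (hM : ∀ s, IsDiagLift N (M s) s)
    {l ls : ℤ} (hls : l * ls ≡ 1 [ZMOD (N : ℤ)]) (d : ℤ) (τ : ℂ) :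
    ∑ᶠ s : SNgroup N, MvPolynomial.aeval
      (fun i => Wseries N (A i) (M s 1 1 * N) (l * (M s 1 1 * d)) τ) F =
    ∑ᶠ s : SNgroup N, MvPolynomial.aeval
      (fun i => Wseries N (A i) (M s 1 1 * N) (M s 1 1 * d) τ) F := by
  have hl : (l : ZMod N) * (ls : ZMod N) = 1 := by
    have := (ZMod.intCast_eq_intCast_iff _ _ N).2 hls
    simpa using this
  let w : (ZMod N)ˣ := ⟨l, ls, hl, by rw [mul_comm, hl]⟩
  symm
  rw [← finsum_comp_equiv (Equiv.mulLeft (QuotientGroup.mk w : SNgroup N))]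
  refine finsum_congr fun s => ?_
  congr 2
  funext i
  simp only [Equiv.coe_mulLeft]
  obtain ⟨x, hx, -, -, -, hx'⟩ := hM s
  obtain ⟨y, hy, -, -, -, hy'⟩ := hM (QuotientGroup.mk w * s)
  have hxy : (QuotientGroup.mk (w * x) : SNgroup N) = QuotientGroup.mk y := by
    rw [hy, QuotientGroup.mk_mul, hx]
  have hzero (z z' : ℤ) : z * N ≡ z' * N [ZMOD N] :=
    (Int.modEq_zero_iff_dvd.2 (dvd_mul_left _ _)).trans
      (Int.modEq_zero_iff_dvd.2 (dvd_mul_left _ _)).symm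
  rcases eq_or_eq_neg_of_mk_eq hxy with h | h
  · have h1 : M (QuotientGroup.mk w * s) 1 1 ≡ l * M s 1 1 [ZMOD N] := by
      rw [← ZMod.intCast_eq_intCast_iff, hy', h]
      push_cast
      rw [hx']
    refine Wseries_congr hN (A i) (hzero _ _) ?_ τ
    rw [← mul_assoc]
    exact h1.mul_right d
  · have h1 : M (QuotientGroup.mk w * s) 1 1 ≡ -(l * M s 1 1) [ZMOD N] := by
      rw [← ZMod.intCast_eq_intCast_iff, hy', h]
      push_cast
      rw [hx']
    rw [← Wseries_neg N (A i) (M s 1 1 * N)]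
    refine Wseries_congr hN (A i) ?_ ?_ τ
    · rw [← neg_mul]
      exact hzero _ _
    · rw [← mul_assoc, ← neg_mul]
      exact h1.mul_right d

lemma HasCommonExpansion.finsum_Wseries {K J : Type*} [Field K] [Nonempty J] {ι : J → K →+* ℂ}
    {N : ℕ} (hN : 0 < N) {ξ : K} {l : J → ℤ} (hι : ∀ i, ι i ξ = zetaN N ^ l i)
    (hl : ∀ i, ∃ ls, l i * ls ≡ 1 [ZMOD N]) {n : ℕ} {A : Fin n → ℤ × ℤ × ℤ}
    (hA : ∀ i, memE N (A i)) (F : MvPolynomial (Fin n) ℤ) {M : SNgroup N → SL(2, ℤ)}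
    (hM : ∀ s, M s ∈ CongruenceSubgroup.Gamma0 N) {c d : ℤ} (hcd : IsCoprime c d) :
    HasCommonExpansion ι N fun i τ => ∑ᶠ s : SNgroup N, MvPolynomial.aeval
      (fun x => _root_.Wseries N (A x) (M s 1 1 * c) (l i * (M s 1 1 * d)) τ) F := by
  have : NeZero N := ⟨hN.ne'⟩
  have : Fintype (SNgroup N) := Fintype.ofFinite _
  simp only [finsum_eq_sum_of_fintype]
  refine HasCommonExpansion.sum _ fun s => HasCommonExpansion.aeval F fun x =>
    HasCommonExpansion.Wseries hN hι (hA x) fun i => ?_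
  obtain ⟨ls, hls⟩ := hl i
  obtain ⟨x, y, hxy⟩ := hcd
  have h10 : (N : ℤ) ∣ M s 1 0 :=
    (ZMod.intCast_zmod_eq_zero_iff_dvd _ _).1 (CongruenceSubgroup.Gamma0_mem.1 (hM s))
  have hdet : M s 0 0 * M s 1 1 ≡ 1 [ZMOD N] := by
    have h := Matrix.SpecialLinearGroup.det_coe (M s)
    rw [Matrix.det_fin_two] at h
    refine Int.modEq_iff_dvd.2 ?_
    have : 1 - M s 0 0 * M s 1 1 = -(M s 0 1 * M s 1 0) := by linear_combination -h
    rw [this, dvd_neg]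
    exact h10.mul_left _
  refine isPrimitiveRow_of_modEq (x := M s 0 0 * x) (y := M s 0 0 * ls * y) ?_
  have h1 := (hls.mul_right (y * d)).add_left (x * c)
  rw [one_mul, hxy] at h1
  have h2 := hdet.mul h1
  rw [one_mul] at h2
  convert h2 using 1
  ring

/-- A common expansion at two primitive roots of unity yields polynomial representatives of the
coefficients. -/
lemma exists_polynomial_hasSum {N : ℕ} (hN : 0 < N) {J : Type*} {l : J → ℤ}
    (hl : ∀ i, IsCoprime (l i) (N : ℤ)) {g : J → ℂ → ℂ}
    (hg : ∀ (K : Type) [Field K] (ξ : K) (ι : J → K →+* ℂ), (∀ i, ι i ξ = zetaN N ^ l i) →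
      HasCommonExpansion ι N g) :
    ∃ (n₀ : ℤ) (P : ℤ → Polynomial ℚ), (∀ m : ℤ, m < n₀ → P m = 0) ∧ ∀ i τ, 0 < τ.im →
      HasSum (fun m : ℤ => Polynomial.aeval (zetaN N ^ l i) (P m) * qq N τ ^ m) (g i τ) := by
  have : Fact (Irreducible (Polynomial.cyclotomic N ℚ)) :=
    ⟨Polynomial.cyclotomic.irreducible_rat hN⟩
  have hroot (i : J) : (Polynomial.cyclotomic N ℚ).eval₂ (algebraMap ℚ ℂ) (zetaN N ^ l i) = 0 := by
    have h := ((isPrimitiveRoot_zetaN hN).zpow_of_gcd_eq_one (l i)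
      (Int.isCoprime_iff_gcd_eq_one.1 (hl i))).isRoot_cyclotomic hN
    rwa [Polynomial.IsRoot, ← Polynomial.map_cyclotomic N (algebraMap ℚ ℂ),
      Polynomial.eval_map] at h
  let ι (i : J) : AdjoinRoot (Polynomial.cyclotomic N ℚ) →+* ℂ :=
    AdjoinRoot.lift (algebraMap ℚ ℂ) (zetaN N ^ l i) (hroot i)
  obtain ⟨k, p, hp⟩ := hg _ (AdjoinRoot.root _) ι fun i => AdjoinRoot.lift_root (hroot i)
  choose r hr using fun n : ℕ => AdjoinRoot.mk_surjective (PowerSeries.coeff n p)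
  refine ⟨-k, fun m => if -(k : ℤ) ≤ m then r (m + k).toNat else 0,
    fun m hm => if_neg (not_le.2 hm), fun i τ hτ => ?_⟩
  have hq := qq_ne_zero N τ
  have hinj : Function.Injective fun n : ℕ => (n : ℤ) - k := fun a b hab => by
    simpa using hab
  rw [← hinj.hasSum_iff]
  · have h := (hp i τ hτ).mul_left (qq N τ ^ k)⁻¹
    rw [inv_mul_cancel_left₀ (pow_ne_zero k hq)] at h
    refine h.congr_fun fun n => ?_
    have h1 : ι i (PowerSeries.coeff n p) = Polynomial.aeval (zetaN N ^ l i) (r n) := by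
      rw [← hr n]
      exact AdjoinRoot.lift_mk (hroot i) (r n)
    simp [h1, zpow_sub₀ hq]
    field_simp
  · intro m hm
    have h : ¬ -(k : ℤ) ≤ m := fun h =>
      hm ⟨(m + k).toNat, by simp only; lia⟩
    simp [h]

/-- Proposition 3.3 (ii) of the paper. `T_{𝔄,F}∘B(t,u,v,k)` (all `𝔞ᵢ ∈ 𝔈₁`) has a
`q`-expansion with coefficients `c_n = P_n(ζ) ∈ ℚ(ζ)`, vanishing below some bound, and applying
`σ_ℓ` to the coefficients yields the `q`-expansion of `T_{𝔄,F}∘B(t,u,v,k)` if `t = N`, and of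
`T_{𝔄,F}∘B(t,ℓ*u,ℓv,ℓk)` if `t ≠ N`. -/
theorem stmt12 (N : ℕ) (hN : 0 < N) {n : ℕ} (A : Fin n → ℤ × ℤ × ℤ)
    (hA : ∀ i, memE1 N (A i)) (F : MvPolynomial (Fin n) ℤ)
    (M : SNgroup N → SL(2, ℤ))
    (hM : ∀ s, M s ∈ CongruenceSubgroup.Gamma0 N ∧ IsDiagLift N (M s) s)
    (t : ℕ) (ht : t ∣ N) (ht0 : 0 < t)
    (u v k : ℤ) (hu : IsCoprime u (t : ℤ)) (huv : u * v ≡ 1 [ZMOD (t : ℤ)])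
    (l ls : ℤ) (hl : IsCoprime l (N : ℤ)) (hls : l * ls ≡ 1 [ZMOD (N : ℤ)]) :
    ∃ (n₀ : ℤ) (P : ℤ → Polynomial ℚ), (∀ m : ℤ, m < n₀ → P m = 0) ∧
      ∀ τ : ℂ, 0 < τ.im →
        (Summable (fun m : ℤ => Polynomial.aeval (zetaN N) (P m) * qq N τ ^ m) ∧
          Tfun N A F M (moebius (Bmat t u v k) τ) =
            ∑' m : ℤ, Polynomial.aeval (zetaN N) (P m) * qq N τ ^ m) ∧
        (Summable (fun m : ℤ => Polynomial.aeval (zetaN N ^ l) (P m) * qq N τ ^ m) ∧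
          (t = N →
            Tfun N A F M (moebius (Bmat t u v k) τ) =
              ∑' m : ℤ, Polynomial.aeval (zetaN N ^ l) (P m) * qq N τ ^ m) ∧
          (t ≠ N →
            Tfun N A F M (moebius (Bmat t (ls * u) (l * v) (l * k)) τ) =
              ∑' m : ℤ, Polynomial.aeval (zetaN N ^ l) (P m) * qq N τ ^ m)) := by
  have hA' (i) : memE N (A i) := (hA i).1
  have hM0 (s) := (hM s).1
  have hcd : IsCoprime (t : ℤ) (v + t * k) := by
    refine ⟨-((u * v - 1) / t + u * k), u, ?_⟩
    have h := det_Bmat huv k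
    rw [Bmat, Matrix.det_fin_two_of] at h
    linear_combination h
  let L : Bool → ℤ := fun b => if b then l else 1
  have hL (i) : IsCoprime (L i) (N : ℤ) := by
    cases i
    · exact isCoprime_one_left
    · exact hl
  have hL' (i) : ∃ ls, L i * ls ≡ 1 [ZMOD N] := by
    cases i
    · exact ⟨1, rfl⟩
    · exact ⟨ls, hls⟩
  obtain ⟨n₀, P, hP, hsum⟩ := exists_polynomial_hasSum hN hL fun K _ ξ ι hι =>
    HasCommonExpansion.finsum_Wseries hN hι hL' hA' F hM0 hcd
  refine ⟨n₀, P, hP, fun τ hτ => ?_⟩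
  have h1 := hsum false τ hτ
  have h2 := hsum true τ hτ
  simp only [L, Bool.false_eq_true, if_false, if_true, zpow_one, one_mul] at h1 h2
  have hT := Tfun_moebius_Bmat hN hA' F hM0 huv k hτ
  refine ⟨⟨h1.summable, hT.trans h1.tsum_eq.symm⟩, h2.summable, ?_, fun _ => ?_⟩
  · rintro rfl
    rw [h2.tsum_eq, hT]
    exact (finsum_Wseries_mul hN A F (fun s => (hM s).2) hls _ τ).symm
  · have huv' : ls * u * (l * v) ≡ 1 [ZMOD (t : ℤ)] := by
      have := (hls.of_dvd (Int.natCast_dvd_natCast.2 ht)).mul huv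
      rw [one_mul] at this
      convert this using 1
      ring
    rw [h2.tsum_eq, Tfun_moebius_Bmat hN hA' F hM0 huv' (l * k) hτ]
    refine finsum_congr fun s => ?_
    congr 2
    funext i
    congr 1
    ring
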